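/- arXiv:2508.05794 — 2 statements merged into one kernel-verified Lean document; each statement's English description precedes it below -/
import Mathlib

section
/- Let 𝕂 be an algebraically closed field and Λ a finite-dimensional 𝕂-algebra of finite global dimension. Let X be an object of D^b(mod Λ) and a < b integers such that b − a > gldim Λ, H^a(X) ≠ 0, H^b(X) ≠ 0, and H^i(X) = 0 for all i with a < i < b. Then X is not indecomposable, i.e. X is isomorphic to a direct sum of two nonzero objects. -/
/-!
**Statement 1.** Let `𝕂` be an algebraically closed field and `Λ` a finite-dimensional
`𝕂`-algebra of finite global dimension.  Let `X` be an object of `D^b(mod Λ)` and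
`a < b` integers such that `b − a > gldim Λ`, `H^a(X) ≠ 0`, `H^b(X) ≠ 0`, and
`H^i(X) = 0` for all `a < i < b`.  Then `X` is not indecomposable, i.e. `X` is
isomorphic to a direct sum of two nonzero objects.

We realise `D^b(mod Λ)` inside `DerivedCategory (ModuleCat Λ)`: an object belongs to it
iff its cohomologies are finite (equivalently, finite-dimensional over `𝕂`) and vanish
outside a bounded range.  The condition `b − a > gldim Λ` (with `gldim Λ` finite) is
expressed by a natural number `d` with `gldim Λ ≤ d` — phrased as the vanishing of all
`Ext`-groups in degrees `> d` — and `b − a > d`.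
-/

open CategoryTheory Limits Pretriangulated

noncomputable section

variable (Λ : Type) [Ring Λ] [HasDerivedCategory (ModuleCat.{0} Λ)]

/-- The `i`-th cohomology of an object of the derived category of `Λ`-modules. -/
def Hgy (i : ℤ) (X : DerivedCategory (ModuleCat.{0} Λ)) : ModuleCat.{0} Λ :=
  (DerivedCategory.homologyFunctor (ModuleCat.{0} Λ) i).obj X

/-- `X` belongs to `D^b(mod Λ)`: bounded cohomology, finite(-dimensional) in each degree. -/
def IsDb (X : DerivedCategory (ModuleCat.{0} Λ)) : Prop :=
  (∃ a b : ℤ, ∀ i : ℤ, (i < a ∨ b < i) → IsZero (Hgy Λ i X)) ∧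
    ∀ i : ℤ, Module.Finite Λ (Hgy Λ i X)

/-- `gldim Λ ≤ d`, expressed by the vanishing of all `Ext`-groups of modules in
degrees `> d`. -/
def gldimLE (d : ℕ) : Prop :=
  ∀ (M N : ModuleCat.{0} Λ) (n : ℕ), d < n →
    IsZero (((Ext ℤ (ModuleCat.{0} Λ) n).obj (Opposite.op M)).obj N)

namespace CategoryTheory

/-- Vanishing of a positive degree left-derived `Ext` gives the vanishing of the `Ext`-group
defined through the derived category. -/
lemma subsingleton_abelianExt_of_isZero_Ext {R C : Type*} [Ring R] [Category* C] [Abelian C]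
    [Linear R C] [EnoughProjectives C] [HasExt C] {M N : C} (p : ℕ)
    (h : IsZero (((Ext R C (p + 1)).obj (Opposite.op M)).obj N)) :
    Subsingleton (Abelian.Ext M N (p + 1)) := by
  let P := projectiveResolution M
  have hP : (P.complex.linearYonedaObj R N).ExactAt (p + 1) := by
    rw [HomologicalComplex.exactAt_iff_isZero_homology]
    exact h.of_iso (P.isoExt (p + 1) N).symm
  rw [HomologicalComplex.exactAt_iff' _ p (p + 1) (p + 2) (by simp) (by simp),
    ShortComplex.moduleCat_exact_iff] at hP
  refine subsingleton_of_forall_eq 0 fun α ↦ ?_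
  obtain ⟨f, hf, rfl⟩ := P.extMk_surjective α (p + 2) rfl
  rw [P.extMk_eq_zero_iff f (p + 2) rfl hf p rfl]
  exact hP f hf

end CategoryTheory

namespace DerivedCategory

open CategoryTheory Triangulated

variable {C : Type*} [Category* C] [Abelian C] [HasDerivedCategory C]

lemma isGE_obj₁_of_distTriang {T : Triangle (DerivedCategory C)}
    (hT : T ∈ distTriang (DerivedCategory C)) (n : ℤ)
    (h₂ : T.obj₂.IsGE n) (h₃ : T.obj₃.IsGE (n - 1)) : T.obj₁.IsGE n :=
  TStructure.t.isGE₂ _ (inv_rot_of_distTriang _ hT) n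
    (TStructure.t.isGE_shift T.obj₃ (n - 1) (-1) n) h₂

lemma isLE_obj₃_of_distTriang {T : Triangle (DerivedCategory C)}
    (hT : T ∈ distTriang (DerivedCategory C)) (n : ℤ)
    (h₁ : T.obj₁.IsLE (n + 1)) (h₂ : T.obj₂.IsLE n) : T.obj₃.IsLE n :=
  TStructure.t.isLE₂ _ (rot_of_distTriang _ hT) n h₂
    (TStructure.t.isLE_shift T.obj₁ (n + 1) 1 n)

/-- A property of objects which is stable under isomorphisms and extensions, and holds for
single complexes in degrees between `a` and `b`, holds for all objects with cohomology
concentrated in these degrees. -/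
lemma prop_of_isGE_of_isLE (P : ObjectProperty (DerivedCategory C))
    [P.IsClosedUnderIsomorphisms] [P.ContainsZero] [P.IsTriangulatedClosed₂] (a b : ℤ)
    (hsingle : ∀ (M : C) (n : ℤ), a ≤ n → n ≤ b → P ((singleFunctor C n).obj M))
    (X : DerivedCategory C) [X.IsGE a] [X.IsLE b] : P X := by
  suffices ∀ (k : ℕ) (n : ℤ) (X : DerivedCategory C), n < a + k → n ≤ b → X.IsGE a → X.IsLE n →
      P X from this (b - a + 1).toNat b X (by lia) le_rfl inferInstance inferInstance
  intro k
  induction k with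
  | zero =>
    intro n X hn _ _ _
    exact P.prop_of_isZero (TStructure.t.isZero X n a (by lia))
  | succ k hk =>
    intro n X hn hb _ _
    by_cases hna : n < a
    · exact P.prop_of_isZero (TStructure.t.isZero X n a)
    obtain ⟨A, B, hA, hB, f, g, δ, hT⟩ := TStructure.t.exists_triangle X (n - 1) n (by lia)
    have : A.IsLE (n - 1) := ⟨hA⟩
    have : B.IsGE n := ⟨hB⟩
    have : A.IsGE a := isGE_obj₁_of_distTriang hT a ‹_› (TStructure.t.isGE_of_ge B _ n)
    have : B.IsLE n := isLE_obj₃_of_distTriang hT n (TStructure.t.isLE_of_le A (n - 1) _) ‹_›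
    obtain ⟨M, ⟨e⟩⟩ := exists_iso_singleFunctor_obj_of_isGE_of_isLE B n
    exact P.ext_of_isTriangulatedClosed₂ _ hT
      (hk (n - 1) A (by lia) (by lia) inferInstance inferInstance)
      (P.prop_of_iso e.symm (hsingle M n (by lia) hb))

/-- If `Ext M N n` vanishes, then so do the morphisms in the derived category
from `M` in degree `p` to `N` in degree `q`, where `p - q = n`. -/
lemma singleFunctor_hom_eq_zero [HasExt C] {M N : C} {n : ℕ} [Subsingleton (Abelian.Ext M N n)]
    {p q : ℤ} (h : q + n = p)
    (f : (singleFunctor C p).obj M ⟶ (singleFunctor C q).obj N) : f = 0 := by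
  let eM := ((singleFunctors C).shiftIso p 0 p (by lia)).app M
  let eN : ((singleFunctor C q).obj N)⟦p⟧ ≅ ((singleFunctor C 0).obj N)⟦(n : ℤ)⟧ :=
    ((singleFunctors C).shiftIso p (-n) q (by lia)).app N ≪≫
      (((singleFunctors C).shiftIso n (-n) 0 (by lia)).app N).symm
  apply (shiftFunctor (DerivedCategory C) p).map_injective
  have hs : Subsingleton ((singleFunctor C 0).obj M ⟶ ((singleFunctor C 0).obj N)⟦(n : ℤ)⟧) :=
    (Abelian.Ext.homEquiv (X := M) (Y := N) (n := n)).symm.subsingleton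
  rw [← cancel_epi eM.inv, ← cancel_mono eN.hom]
  exact hs.elim _ _

/-- If the `Ext`-groups vanish in degrees `≥ b - a`, there are no nonzero morphisms from bounded
objects in degrees `≥ b` to bounded objects in degrees `≤ a`. -/
lemma hom_eq_zero_of_subsingleton_ext [HasExt C] (a b : ℤ)
    (hExt : ∀ (M N : C) (n : ℕ), b - a ≤ n → Subsingleton (Abelian.Ext M N n))
    (hab : a ≤ b) (lo hi : ℤ) {X Y : DerivedCategory C}
    [X.IsGE b] [X.IsLE hi] [Y.IsGE lo] [Y.IsLE a] (f : X ⟶ Y) : f = 0 := by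
  have hY (M : C) (p : ℤ) (hp : b ≤ p) :
      (ObjectProperty.singleton ((singleFunctor C p).obj M)).rightOrthogonal Y := by
    apply prop_of_isGE_of_isLE _ lo a
    rintro N q - hq _ g ⟨⟩
    have := hExt M N (p - q).toNat (by lia)
    exact singleFunctor_hom_eq_zero (n := (p - q).toNat) (by lia) g
  have hX : (ObjectProperty.singleton Y).leftOrthogonal X := by
    apply prop_of_isGE_of_isLE _ b hi
    rintro M p hp - _ g ⟨⟩
    exact hY M p hp g (by simp)
  exact hX f (by simp)

/-- If the cohomology of `X` vanishes in degrees `a < i < b`, the third vertex of a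
truncation triangle in degree `a` is `≥ b`. -/
lemma isGE_of_distTriang_of_isZero {T : Triangle (DerivedCategory C)}
    (hT : T ∈ distTriang (DerivedCategory C)) (a b : ℤ) (h₁ : T.obj₁.IsLE a)
    (h₃ : T.obj₃.IsGE (a + 1))
    (h : ∀ i, a < i → i < b → IsZero ((homologyFunctor C i).obj T.obj₂)) :
    T.obj₃.IsGE b := by
  rw [isGE_iff]
  intro i hi
  by_cases hia : a < i
  · have : (T.obj₁⟦(1 : ℤ)⟧).IsLE (a - 1) := TStructure.t.isLE_shift _ a 1 (a - 1)
    exact ((homologyFunctor C i).map_distinguished_exact _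
      (rot_of_distTriang _ hT)).isZero_of_both_zeros
      ((h i hia hi).eq_of_src _ _)
      ((isZero_of_isLE (T.obj₁⟦(1 : ℤ)⟧) (a - 1) i (by lia)).eq_of_tgt _ _)
  · exact isZero_of_isGE _ (a + 1) i (by lia)

/-- A bounded object whose cohomology vanishes strictly between `a` and `b` decomposes as a
direct sum of an object `≤ a` and an object `≥ b`, if `Ext` vanishes in degrees `> b - a`. -/
lemma exists_iso_biprod_of_isZero_homology [HasExt C] (a b : ℤ) (hab : a < b)
    (hExt : ∀ (M N : C) (n : ℕ), b - a < n → Subsingleton (Abelian.Ext M N n))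
    (lo hi : ℤ) (X : DerivedCategory C) [X.IsGE lo] [X.IsLE hi]
    (h : ∀ i, a < i → i < b → IsZero ((homologyFunctor C i).obj X)) :
    ∃ (Y Z : DerivedCategory C), Y.IsLE a ∧ Z.IsGE b ∧ Nonempty (X ≅ Y ⊞ Z) := by
  obtain ⟨A, B, hA, hB, f, g, δ, hT⟩ := TStructure.t.exists_triangle X a (a + 1) rfl
  replace hA : A.IsLE a := ⟨hA⟩
  replace hB : B.IsGE (a + 1) := ⟨hB⟩
  have hB' : B.IsGE b := isGE_of_distTriang_of_isZero hT a b hA hB h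
  have : A.IsGE (min lo (a + 2)) := isGE_obj₁_of_distTriang hT _
    (TStructure.t.isGE_of_ge X _ lo) (TStructure.t.isGE_of_ge B _ (a + 1))
  have : B.IsLE (max hi (a - 1)) := isLE_obj₃_of_distTriang hT _
    (TStructure.t.isLE_of_le A a _) (TStructure.t.isLE_of_le X hi _)
  have : (A⟦(1 : ℤ)⟧).IsGE (min lo (a + 2) - 1) :=
    TStructure.t.isGE_shift A (min lo (a + 2)) 1 _
  have : (A⟦(1 : ℤ)⟧).IsLE (a - 1) := TStructure.t.isLE_shift A a 1 (a - 1)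
  have hδ : δ = 0 := hom_eq_zero_of_subsingleton_ext (a - 1) b
    (fun M N n hn ↦ hExt M N n (by lia)) (by lia) (min lo (a + 2) - 1) (max hi (a - 1)) δ
  obtain ⟨e, -⟩ := exists_iso_binaryBiproduct_of_distTriang _ hT hδ
  exact ⟨A, B, hA, hB', ⟨e⟩⟩

end DerivedCategory

theorem not_indecomposable_of_cohomology_gap
    (𝕂 : Type) [Field 𝕂] [IsAlgClosed 𝕂] [Algebra 𝕂 Λ] [FiniteDimensional 𝕂 Λ]
    (d : ℕ) (hgl : gldimLE Λ d)
    (X : DerivedCategory (ModuleCat.{0} Λ)) (hX : IsDb Λ X)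
    (a b : ℤ) (hab : a < b) (hgap : (d : ℤ) < b - a)
    (ha : ¬ IsZero (Hgy Λ a X)) (hb : ¬ IsZero (Hgy Λ b X))
    (hmid : ∀ i : ℤ, a < i → i < b → IsZero (Hgy Λ i X)) :
    ∃ (Y Z : DerivedCategory (ModuleCat.{0} Λ)),
      ¬ IsZero Y ∧ ¬ IsZero Z ∧ Nonempty (X ≅ Y ⊞ Z) := by
  obtain ⟨⟨lo, hi, hbd⟩, -⟩ := hX
  have : X.IsGE lo := by
    rw [DerivedCategory.isGE_iff]
    exact fun i hi' ↦ hbd i (Or.inl hi')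
  have : X.IsLE hi := by
    rw [DerivedCategory.isLE_iff]
    exact fun i hi' ↦ hbd i (Or.inr hi')
  obtain ⟨Y, Z, hY, hZ, ⟨e⟩⟩ := DerivedCategory.exists_iso_biprod_of_isZero_homology a b hab
    (fun M N n hn ↦ by
      obtain ⟨p, rfl⟩ : ∃ p, n = p + 1 := ⟨n - 1, by lia⟩
      exact subsingleton_abelianExt_of_isZero_Ext p (hgl M N (p + 1) (by lia)))
    lo hi X hmid
  refine ⟨Y, Z, fun hY0 ↦ ha ?_, fun hZ0 ↦ hb ?_, ⟨e⟩⟩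
  · have : X.IsGE b := DerivedCategory.TStructure.t.isGE_of_iso
      (isoZeroBiprod hY0 ≪≫ e.symm) b
    exact X.isZero_of_isGE b a hab
  · have : X.IsLE a := DerivedCategory.TStructure.t.isLE_of_iso
      (isoBiprodZero hZ0 ≪≫ e.symm) a
    exact X.isZero_of_isLE a b hab

end
end

section
/- Let 𝕂 be an algebraically closed field and Λ a finite-dimensional 𝕂-algebra of finite global dimension. Let X be an indecomposable object of D^{[a,b]}(mod Λ) with H^a(X) ≠ 0 and H^b(X) ≠ 0. Then the number of indices i with H^i(X) ≠ 0 is at least (b − a)/gldim Λ. -/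
/-!
**Statement 2.** Let `𝕂` be an algebraically closed field and `Λ` a finite-dimensional
`𝕂`-algebra of finite global dimension.  Let `X` be an indecomposable object of
`D^{[a,b]}(mod Λ)` with `H^a(X) ≠ 0` and `H^b(X) ≠ 0`.  Then the number of indices `i`
with `H^i(X) ≠ 0` is at least `(b − a)/gldim Λ`.

The global dimension is encoded by a natural number `d` with `gldim Λ ≤ d` (vanishing
of `Ext`-groups in degrees `> d`); the conclusion `card ≥ (b − a)/d` for every such `d`
is equivalent to the stated bound `(b − a)/gldim Λ`.
-/

open CategoryTheory Limits Pretriangulated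

noncomputable section

variable (Λ : Type) [Ring Λ] [HasDerivedCategory (ModuleCat.{0} Λ)]

namespace CategoryTheory.ProjectiveResolution

open Abelian

variable {C : Type*} [Category* C] [Abelian C] [EnoughProjectives C]

/-- Vanishing of the derived-functor `Ext` in positive degree implies the vanishing of
the `Ext`-groups defined using the derived category. -/
lemma abelianExt_eq_zero_of_isZero_Ext [HasExt C] (X Y : C) (n : ℕ)
    (h : IsZero (((_root_.Ext ℤ C (n + 1)).obj (Opposite.op X)).obj Y))
    (e : Abelian.Ext X Y (n + 1)) : e = 0 := by
  let P := projectiveResolution X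
  obtain ⟨f, hf, rfl⟩ := P.extMk_surjective e (n + 2) rfl
  rw [P.extMk_eq_zero_iff f (n + 2) rfl hf n rfl]
  have h' := h.of_iso (P.isoExt (R := ℤ) (n + 1) Y).symm
  rw [← HomologicalComplex.exactAt_iff_isZero_homology,
    HomologicalComplex.exactAt_iff' _ n (n + 1) (n + 2) (by simp) (by simp),
    ShortComplex.moduleCat_exact_iff] at h'
  exact h' f hf

end CategoryTheory.ProjectiveResolution

namespace DerivedCategory

variable {C : Type*} [Category* C] [Abelian C] [HasDerivedCategory C]

section Triangle

variable {T : Triangle (DerivedCategory C)} (hT : T ∈ distTriang _)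

include hT

lemma isZero_homology_obj₁ (i : ℤ)
    (h₃ : IsZero ((homologyFunctor C (i - 1)).obj T.obj₃))
    (h₂ : IsZero ((homologyFunctor C i).obj T.obj₂)) :
    IsZero ((homologyFunctor C i).obj T.obj₁) :=
  (HomologySequence.exact₁ T hT (i - 1) i).isZero_of_both_zeros
    (h₃.eq_of_src _ _) (h₂.eq_of_tgt _ _)

lemma isZero_homology_obj₂ (i : ℤ)
    (h₁ : IsZero ((homologyFunctor C i).obj T.obj₁))
    (h₃ : IsZero ((homologyFunctor C i).obj T.obj₃)) :
    IsZero ((homologyFunctor C i).obj T.obj₂) :=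
  (HomologySequence.exact₂ T hT i).isZero_of_both_zeros
    (h₁.eq_of_src _ _) (h₃.eq_of_tgt _ _)

lemma isZero_homology_obj₃ (i : ℤ)
    (h₂ : IsZero ((homologyFunctor C i).obj T.obj₂))
    (h₁ : IsZero ((homologyFunctor C (i + 1)).obj T.obj₁)) :
    IsZero ((homologyFunctor C i).obj T.obj₃) :=
  (HomologySequence.exact₃ T hT i (i + 1)).isZero_of_both_zeros
    (h₂.eq_of_src _ _) (h₁.eq_of_tgt _ _)

end Triangle

/-- A property of objects which holds for objects concentrated in a single degree of `[a, b]`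
and which is stable under extensions holds for all objects with cohomology in `[a, b]`. -/
lemma induction_of_isGE_of_isLE (P : ObjectProperty (DerivedCategory C))
    (hext : ∀ T ∈ distTriang (DerivedCategory C), P T.obj₁ → P T.obj₃ → P T.obj₂)
    (a b : ℤ) (hab : a ≤ b)
    (hsingle : ∀ (X : DerivedCategory C) (n : ℤ), a ≤ n → n ≤ b → X.IsGE n → X.IsLE n → P X)
    (X : DerivedCategory C) (hXa : X.IsGE a) (hXb : X.IsLE b) : P X := by
  induction b, hab using Int.leInduction generalizing X with
  | base => exact hsingle X a le_rfl le_rfl hXa hXb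
  | succ b hab ih =>
    obtain ⟨A, B, hA, hB, f, g, h, hT⟩ := TStructure.t.exists_triangle X b (b + 1) rfl
    replace hA : A.IsLE b := ⟨hA⟩
    replace hB : B.IsGE (b + 1) := ⟨hB⟩
    refine hext _ hT (ih (fun Y n hn hn' ↦ hsingle Y n hn (by lia)) A ?_ hA)
      (hsingle B (b + 1) (by lia) le_rfl hB ?_)
    · rw [isGE_iff]
      exact fun i hi ↦ isZero_homology_obj₁ hT i (B.isZero_of_isGE (b + 1) _ (by lia))
        (X.isZero_of_isGE a i hi)
    · rw [isLE_iff]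
      exact fun i hi ↦ isZero_homology_obj₃ hT i (X.isZero_of_isLE (b + 1) i hi)
        (A.isZero_of_isLE b _ (by lia))

section Vanishing

variable {d : ℤ}
  (hd : ∀ (M N : C) (n : ℤ), d < n →
    ∀ f : (singleFunctor C 0).obj M ⟶ ((singleFunctor C 0).obj N)⟦n⟧, f = 0)

include hd

lemma eq_zero_of_concentrated {Y Z : DerivedCategory C} (p q : ℤ)
    (hYp : Y.IsGE p) (hYp' : Y.IsLE p) (hZq : Z.IsGE q) (hZq' : Z.IsLE q)
    (hpq : d < p - q) (f : Y ⟶ Z) : f = 0 := by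
  obtain ⟨M, ⟨eY⟩⟩ := Y.exists_iso_singleFunctor_obj_of_isGE_of_isLE p
  obtain ⟨N, ⟨eZ⟩⟩ := Z.exists_iso_singleFunctor_obj_of_isGE_of_isLE q
  let uY : Y⟦p⟧ ≅ (singleFunctor C 0).obj M :=
    (shiftFunctor _ p).mapIso eY ≪≫ ((singleFunctors C).shiftIso p 0 p (by lia)).app M
  let uZ : Z⟦p⟧ ≅ ((singleFunctor C 0).obj N)⟦p - q⟧ :=
    (shiftFunctor _ p).mapIso eZ ≪≫ ((singleFunctors C).shiftIso p (q - p) q (by lia)).app N ≪≫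
      (((singleFunctors C).shiftIso (p - q) (q - p) 0 (by lia)).app N).symm
  apply (shiftFunctor (DerivedCategory C) p).map_injective
  rw [← cancel_epi uY.inv, ← cancel_mono uZ.hom, Category.assoc,
    hd M N (p - q) hpq (uY.inv ≫ f⟦p⟧' ≫ uZ.hom)]
  simp

lemma eq_zero_of_isGE_of_isLE {Y Z : DerivedCategory C} (p p' q' q : ℤ)
    (hp : p ≤ p') (hq : q' ≤ q)
    (hYp : Y.IsGE p) (hYp' : Y.IsLE p') (hZq' : Z.IsGE q') (hZq : Z.IsLE q)
    (hpq : d < p - q) (f : Y ⟶ Z) : f = 0 := by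
  refine induction_of_isGE_of_isLE (fun Y ↦ ∀ f : Y ⟶ Z, f = 0) ?_ p p' hp ?_ Y hYp hYp' f
  · intro T hT h₁ h₃ f
    obtain ⟨g, rfl⟩ := T.yoneda_exact₂ hT f (h₁ _)
    rw [h₃ g, comp_zero]
  · intro Y n hn _ hYn hYn'
    refine induction_of_isGE_of_isLE (fun Z ↦ ∀ f : Y ⟶ Z, f = 0) ?_ q' q hq ?_ Z hZq' hZq
    · intro T hT h₁ h₃ f
      obtain ⟨g, rfl⟩ := T.coyoneda_exact₂ hT f (h₃ _)
      rw [h₁ g, zero_comp]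
    · intro Z m _ hm hZm hZm' f
      exact eq_zero_of_concentrated hd n m hYn hYn' hZm hZm' (by lia) f

/-- If `Ext`-groups vanish in degrees `> d`, an indecomposable object has no
`d` consecutive vanishing cohomology objects between two nonvanishing ones. -/
lemma exists_not_isZero_homology_of_indecomposable
    (X : DerivedCategory C) (a b : ℤ)
    (hXa : X.IsGE a) (hXb : X.IsLE b)
    (ha : ¬ IsZero ((homologyFunctor C a).obj X)) (hb : ¬ IsZero ((homologyFunctor C b).obj X))
    (hindec : ∀ Y Z : DerivedCategory C, (X ≅ Y ⊞ Z) → IsZero Y ∨ IsZero Z)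
    (i : ℤ) (hai : a ≤ i) (hib : i < b) :
    ∃ k, i < k ∧ k ≤ i + d ∧ ¬ IsZero ((homologyFunctor C k).obj X) := by
  by_contra! H
  have hdb : i + d < b := by
    by_contra! h
    exact hb (H b hib h)
  obtain ⟨A, B, hA, hB, f, g, h, hT⟩ := TStructure.t.exists_triangle X i (i + 1) rfl
  replace hA : A.IsLE i := ⟨hA⟩
  replace hB : B.IsGE (i + 1) := ⟨hB⟩
  have hA' : A.IsGE a := by
    rw [isGE_iff]
    exact fun k hk ↦ isZero_homology_obj₁ hT k (B.isZero_of_isGE (i + 1) _ (by lia))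
      (X.isZero_of_isGE a k hk)
  have hB' : B.IsLE b := by
    rw [isLE_iff]
    exact fun k hk ↦ isZero_homology_obj₃ hT k (X.isZero_of_isLE b k hk)
      (A.isZero_of_isLE i _ (by lia))
  have hB'' : B.IsGE (i + d + 1) := by
    rw [isGE_iff]
    intro k hk
    by_cases hki : k < i + 1
    · exact B.isZero_of_isGE (i + 1) k hki
    · exact isZero_homology_obj₃ hT k (H k (by lia) (by lia)) (A.isZero_of_isLE i _ (by lia))
  have hh : h = 0 := eq_zero_of_isGE_of_isLE hd (i + d + 1) b (a - 1) (i - 1) (by lia) (by lia)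
    hB'' hB' (TStructure.t.isGE_shift A a 1 (a - 1)) (TStructure.t.isLE_shift A i 1 (i - 1))
    (by lia) h
  obtain ⟨e, -⟩ := exists_iso_binaryBiproduct_of_distTriang _ hT hh
  rcases hindec A B e with hz | hz
  · exact ha (isZero_homology_obj₂ hT a ((homologyFunctor C a).map_isZero hz)
      (B.isZero_of_isGE (i + 1) a (by lia)))
  · exact hb (isZero_homology_obj₂ hT b (A.isZero_of_isLE i b hib)
      ((homologyFunctor C b).map_isZero hz))

end Vanishing

end DerivedCategory

lemma gldimLE.hom_eq_zero {Λ : Type} [Ring Λ] [HasDerivedCategory (ModuleCat.{0} Λ)]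
    {d : ℕ} (hgl : gldimLE Λ d) (M N : ModuleCat.{0} Λ) (n : ℤ) (hn : (d : ℤ) < n)
    (f : (DerivedCategory.singleFunctor _ 0).obj M ⟶
      ((DerivedCategory.singleFunctor _ 0).obj N)⟦n⟧) : f = 0 := by
  have := hasExt_of_hasDerivedCategory (ModuleCat.{0} Λ)
  obtain ⟨m, rfl⟩ : ∃ m : ℕ, n = ((m + 1 : ℕ) : ℤ) := ⟨(n - 1).toNat, by lia⟩
  obtain ⟨e, rfl⟩ := (Abelian.Ext.homEquiv (X := M) (Y := N) (n := m + 1)).surjective f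
  rw [ProjectiveResolution.abelianExt_eq_zero_of_isZero_Ext M N m (hgl M N _ (by lia)) e]
  exact Abelian.Ext.zero_hom ..

theorem card_nonzero_cohomologies_of_indecomposable
    (𝕂 : Type) [Field 𝕂] [IsAlgClosed 𝕂] [Algebra 𝕂 Λ] [FiniteDimensional 𝕂 Λ]
    (d : ℕ) (hgl : gldimLE Λ d)
    (X : DerivedCategory (ModuleCat.{0} Λ))
    (a b : ℤ)
    (hX : ∀ i : ℤ, (i < a ∨ b < i) → IsZero (Hgy Λ i X))
    (hfin : ∀ i : ℤ, Module.Finite Λ (Hgy Λ i X))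
    (ha : ¬ IsZero (Hgy Λ a X)) (hb : ¬ IsZero (Hgy Λ b X))
    (hindec : ∀ (Y Z : DerivedCategory (ModuleCat.{0} Λ)),
      (X ≅ Y ⊞ Z) → IsZero Y ∨ IsZero Z) :
    ∀ s : Finset ℤ, (∀ i : ℤ, i ∈ s ↔ ¬ IsZero (Hgy Λ i X)) →
      ((b : ℝ) - (a : ℝ)) / (d : ℝ) ≤ (s.card : ℝ) := by
  intro s hs
  rcases Nat.eq_zero_or_pos d with rfl | hd
  · simp
  have hcover : Finset.Ico a b ⊆ s.biUnion fun k ↦ Finset.Ico (k - d) k := by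
    intro i hi
    rw [Finset.mem_Ico] at hi
    obtain ⟨k, hik, hkd, hk⟩ := DerivedCategory.exists_not_isZero_homology_of_indecomposable
      hgl.hom_eq_zero X a b
      ((DerivedCategory.isGE_iff X a).2 fun j hj ↦ hX j (Or.inl hj))
      ((DerivedCategory.isLE_iff X b).2 fun j hj ↦ hX j (Or.inr hj))
      ha hb hindec i hi.1 hi.2
    rw [Finset.mem_biUnion]
    exact ⟨k, (hs k).2 hk, Finset.mem_Ico.2 ⟨by lia, hik⟩⟩
  have hcard : (b - a).toNat ≤ s.card * d := by
    rw [← Int.card_Ico]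
    exact (Finset.card_le_card hcover).trans
      (Finset.card_biUnion_le_card_mul _ _ _ fun k _ ↦ by simp)
  rw [div_le_iff₀ (by exact_mod_cast hd)]
  have hle : b - a ≤ s.card * d := by
    zify at hcard
    exact (Int.self_le_toNat _).trans hcard
  exact_mod_cast hle

end
end
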